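/- arXiv:0704.3603 — 2 statements merged into one kernel-verified Lean document; each statement's English description precedes it below -/
import Mathlib

section
/- Let G be a graph on r vertices with r + s − 1 edges possessing a spanning tree T such that every simple path from the root of T has vertex-degree sum at most m. Then the relaxation time of the (continuous-time) Gibbs sampler for the Ising model on G, with interactions bounded by β, arbitrary boundary conditions and external fields, is at most exp(4β(m + s)). -/
/-- The spin value `±1` of a Boolean configuration entry. -/
def spin (b : Bool) : ℝ := if b then 1 else -1

namespace Glauber

open Finset Relation

variable {V : Type*} [DecidableEq V]

/-- The configuration `σ` with the spin at `v` reversed. -/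
def flip (σ : V → Bool) (v : V) : V → Bool := Function.update σ v (! σ v)

/-- The conductance of the heat-bath dynamics between `σ` and `flip σ v`. -/
noncomputable def conductance (a : (V → Bool) → ℝ) (v : V) (σ : V → Bool) : ℝ :=
  a σ * (a (flip σ v) / (a σ + a (flip σ v)))

lemma flip_flip (σ : V → Bool) (v : V) : flip (flip σ v) v = σ := by
  simp [flip]

lemma flip_apply_of_ne (σ : V → Bool) {v u : V} (h : u ≠ v) : flip σ v u = σ u := by
  simp [flip, h]

lemma conductance_pos {a : (V → Bool) → ℝ} (ha : ∀ σ, 0 < a σ) (v : V) (σ : V → Bool) :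
    0 < conductance a v σ := by
  have h1 := ha σ
  have h2 := ha (flip σ v)
  unfold conductance
  positivity

lemma conductance_mul_right {a b : (V → Bool) → ℝ} (hb : ∀ σ, 0 < b σ) {v : V} {σ : V → Bool}
    (h : b (flip σ v) = b σ) :
    conductance (fun σ => a σ * b σ) v σ = conductance a v σ * b σ := by
  have := (hb σ).ne'
  simp only [conductance]
  rw [h, ← add_mul, mul_div_mul_right _ _ this]
  ring

lemma conductance_le_of_le {a b : (V → Bool) → ℝ} (ha : ∀ σ, 0 < a σ) (hb : ∀ σ, 0 < b σ)
    {K : ℝ} (hK : 0 < K) (hab : ∀ σ, a σ ≤ K * b σ) (v : V) (σ : V → Bool) :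
    conductance a v σ ≤ K * conductance b v σ := by
  have key : ∀ x y x' y' : ℝ, 0 < x → 0 < y → 0 < x' → 0 < y' → x ≤ K * x' → y ≤ K * y' →
      x * (y / (x + y)) ≤ K * (x' * (y' / (x' + y'))) := by
    intro x y x' y' hx hy hx' hy' h1 h2
    have e1 : x * (y / (x + y)) = (x⁻¹ + y⁻¹)⁻¹ := by field_simp; rw [add_comm]
    have e2 : K * (x' * (y' / (x' + y'))) = ((K * x')⁻¹ + (K * y')⁻¹)⁻¹ := by
      field_simp; rw [add_comm]
    rw [e1, e2]
    gcongr
  exact key _ _ _ _ (ha _) (ha _) (hb _) (hb _) (hab _) (hab _)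

lemma flip_piecewise_of_mem {S : Finset V} {v : V} (hv : v ∈ S) (τ σ : V → Bool) :
    S.piecewise (flip τ v) σ = flip (S.piecewise τ σ) v := by
  funext x
  by_cases hx : x = v
  · subst hx; simp [flip, hv]
  · by_cases hxS : x ∈ S <;> simp [flip, hx, hxS]

lemma flip_piecewise_of_notMem {S : Finset V} {v : V} (hv : v ∉ S) (τ σ : V → Bool) :
    S.piecewise τ (flip σ v) = flip (S.piecewise τ σ) v := by
  funext x
  by_cases hx : x = v
  · subst hx; simp [flip, hv]
  · by_cases hxS : x ∈ S <;> simp [flip, hx, hxS]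

variable [Fintype V]

/-- The contribution of the site `v` to the unnormalized Dirichlet form of the heat-bath dynamics
for the weight `a`. -/
noncomputable def energy (a : (V → Bool) → ℝ) (v : V) (f : (V → Bool) → ℝ) : ℝ :=
  (1 / 2) * ∑ σ, conductance a v σ * (f (flip σ v) - f σ) ^ 2

/-- The Poincaré inequality with constant `C` for the heat-bath dynamics of the weight `a` on the
sites in `S`. -/
def Poincare (a : (V → Bool) → ℝ) (S : Finset V) (C : ℝ) : Prop :=
  ∀ f : (V → Bool) → ℝ, DependsOn f (S : Set V) →
    ∃ c : ℝ, ∑ σ, a σ * (f σ - c) ^ 2 ≤ C * ∑ v ∈ S, energy a v f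

lemma energy_nonneg {a : (V → Bool) → ℝ} (ha : ∀ σ, 0 < a σ) (v : V) (f : (V → Bool) → ℝ) :
    0 ≤ energy a v f :=
  mul_nonneg (by norm_num) (sum_nonneg fun σ _ =>
    mul_nonneg (conductance_pos ha v σ).le (sq_nonneg _))

lemma Poincare.mono {a : (V → Bool) → ℝ} (ha : ∀ σ, 0 < a σ) {S : Finset V} {C C' : ℝ}
    (hC : C ≤ C') (h : Poincare a S C) : Poincare a S C' := fun f hf =>
  (h f hf).imp fun _ hc => hc.trans
    (mul_le_mul_of_nonneg_right hC (sum_nonneg fun v _ => energy_nonneg ha v f))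

/-- Changing the weight by factors between `exp (-k)` and `exp k` costs at most `exp (2 * k)` in
the Poincaré constant. -/
lemma Poincare.perturb {a b : (V → Bool) → ℝ} (ha : ∀ σ, 0 < a σ) (hb : ∀ σ, 0 < b σ)
    {S : Finset V} {C k : ℝ} (hC : 0 ≤ C) (hab : ∀ σ, a σ ≤ Real.exp k * b σ)
    (hba : ∀ σ, b σ ≤ Real.exp k * a σ) (h : Poincare a S C) :
    Poincare b S (Real.exp (2 * k) * C) := by
  intro f hf
  obtain ⟨c, hc⟩ := h f hf
  refine ⟨c, ?_⟩
  have hk := Real.exp_pos k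
  have hE : ∀ v, energy a v f ≤ Real.exp k * energy b v f := by
    intro v
    unfold energy
    rw [mul_left_comm, mul_sum _ _ (Real.exp k)]
    refine mul_le_mul_of_nonneg_left (sum_le_sum fun σ _ => ?_) (one_half_pos (α := ℝ)).le
    rw [← mul_assoc]
    exact mul_le_mul_of_nonneg_right (conductance_le_of_le ha hb hk hab v σ) (sq_nonneg _)
  calc ∑ σ, b σ * (f σ - c) ^ 2 ≤ ∑ σ, Real.exp k * (a σ * (f σ - c) ^ 2) := by
        refine sum_le_sum fun σ _ => ?_
        rw [← mul_assoc]
        exact mul_le_mul_of_nonneg_right (hba σ) (sq_nonneg _)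
    _ = Real.exp k * ∑ σ, a σ * (f σ - c) ^ 2 := by rw [mul_sum]
    _ ≤ Real.exp k * (C * ∑ v ∈ S, energy a v f) := by gcongr
    _ ≤ Real.exp k * (C * ∑ v ∈ S, Real.exp k * energy b v f) := by
        gcongr with v
        exact hE v
    _ = Real.exp (2 * k) * C * ∑ v ∈ S, energy b v f := by
        rw [← mul_sum, two_mul, Real.exp_add]; ring

lemma sum_flip {M : Type*} [AddCommMonoid M] (F : (V → Bool) → M) (v : V) :
    ∑ σ, F (flip σ v) = ∑ σ, F σ :=
  Fintype.sum_equiv (Function.Involutive.toPerm (fun σ => flip σ v) fun σ => flip_flip σ v)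
    _ _ fun _ => rfl

lemma poincare_singleton {a : (V → Bool) → ℝ} (ha : ∀ σ, 0 < a σ) (v : V)
    (hav : DependsOn a ({v} : Set V)) : Poincare a {v} 1 := by
  intro f hf
  rw [coe_singleton] at hf
  set t : V → Bool := fun _ => true
  set u : V → Bool := fun _ => false
  have hat := ha t
  have hau := ha u
  refine ⟨(a t * f t + a u * f u) / (a t + a u), ?_⟩
  set c := (a t * f t + a u * f u) / (a t + a u) with hc
  have pair : ∀ σ, a σ * (f σ - c) ^ 2 + a (flip σ v) * (f (flip σ v) - c) ^ 2
      = conductance a v σ * (f (flip σ v) - f σ) ^ 2 := by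
    intro σ
    unfold conductance
    cases hσ : σ v
    · have h1 : a σ = a u := hav (by simp [hσ, u])
      have h2 : a (flip σ v) = a t := hav (by simp [hσ, t, flip])
      have h3 : f σ = f u := hf (by simp [hσ, u])
      have h4 : f (flip σ v) = f t := hf (by simp [hσ, t, flip])
      rw [h1, h2, h3, h4, hc]
      field_simp
      ring
    · have h1 : a σ = a t := hav (by simp [hσ, t])
      have h2 : a (flip σ v) = a u := hav (by simp [hσ, u, flip])
      have h3 : f σ = f t := hf (by simp [hσ, t])
      have h4 : f (flip σ v) = f u := hf (by simp [hσ, u, flip])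
      rw [h1, h2, h3, h4, hc]
      field_simp
      ring
  rw [sum_singleton, one_mul, energy, ← sum_congr rfl fun σ _ => pair σ, sum_add_distrib,
    sum_flip (fun σ => a σ * (f σ - c) ^ 2) v]
  linarith

lemma card_mul_sum_eq (S : Finset V) (F : (V → Bool) → ℝ) :
    ∑ σ : V → Bool, ∑ τ : V → Bool, F (S.piecewise τ σ) = Fintype.card (V → Bool) * ∑ σ, F σ := by
  have hinv : Function.Involutive (fun p : (V → Bool) × (V → Bool) =>
      (S.piecewise p.1 p.2, S.piecewise p.2 p.1)) := by
    rintro ⟨τ, σ⟩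
    ext x <;> by_cases hx : x ∈ S <;> simp [hx]
  calc ∑ σ : V → Bool, ∑ τ : V → Bool, F (S.piecewise τ σ)
      = ∑ p : (V → Bool) × (V → Bool), F (S.piecewise p.1 p.2) := by
        rw [sum_comm, ← Fintype.sum_prod_type']
    _ = ∑ p : (V → Bool) × (V → Bool), F p.1 :=
        Fintype.sum_equiv hinv.toPerm _ _ fun _ => rfl
    _ = _ := by
        simp [Fintype.sum_prod_type, mul_sum]

/-- Tensorization of the Poincaré inequality. -/
lemma Poincare.mul {a b : (V → Bool) → ℝ} (ha : ∀ σ, 0 < a σ) (hb : ∀ σ, 0 < b σ)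
    {S S' : Finset V} (hd : Disjoint S S') (haS : DependsOn a (S : Set V))
    (hbS : DependsOn b (S' : Set V)) {C : ℝ} (hC : 0 ≤ C)
    (hPa : Poincare a S C) (hPb : Poincare b S' C) :
    Poincare (fun σ => a σ * b σ) (S ∪ S') C := by
  intro f hf
  have hS' : ∀ x ∈ S', x ∉ S := fun x hx hx' => disjoint_left.mp hd hx' hx
  set A := ∑ τ, a τ with hA
  have hApos : 0 < A := sum_pos (fun σ _ => ha σ) univ_nonempty
  let F : (V → Bool) → (V → Bool) → ℝ := fun τ σ => f (S.piecewise τ σ)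
  let g : (V → Bool) → ℝ := fun σ => (∑ τ, a τ * F τ σ) / A
  have hFσ : ∀ σ, DependsOn (fun τ => F τ σ) (S : Set V) := by
    intro σ τ τ' h
    refine hf fun x hx => ?_
    by_cases hxS : x ∈ S
    · simpa [hxS] using h x hxS
    · simp [hxS]
  have hg : DependsOn g (S' : Set V) := by
    intro σ σ' h
    have : ∀ τ, F τ σ = F τ σ' := by
      intro τ
      refine hf fun x hx => ?_
      by_cases hxS : x ∈ S
      · simp [hxS]
      · have : x ∈ S' := by simpa [hxS] using hx
        simpa [hxS] using h x this
    simp only [g, this]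
  have hapw : ∀ τ σ, a (S.piecewise τ σ) = a τ := fun τ σ => haS fun x hx => by
    simp [mem_coe.mp hx]
  have hbpw : ∀ τ σ, b (S.piecewise τ σ) = b σ := fun τ σ => hbS fun x hx => by
    simp [hS' x (mem_coe.mp hx)]
  have haflip : ∀ v ∈ S', ∀ σ, a (flip σ v) = a σ := fun v hv σ => haS fun x hx =>
    flip_apply_of_ne σ fun h => hS' v hv (h ▸ hx)
  have hbflip : ∀ v ∈ S, ∀ σ, b (flip σ v) = b σ := fun v hv σ => hbS fun x hx =>
    flip_apply_of_ne σ fun h => hS' x hx (h ▸ hv)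
  have hsplit : ∀ σ c, ∑ τ, a τ * (F τ σ - c) ^ 2
        = ∑ τ, a τ * (F τ σ - g σ) ^ 2 + (g σ - c) ^ 2 * A := by
    intro σ c
    have hgA : ∑ τ, a τ * F τ σ = g σ * A := by simp only [g]; field_simp
    have e : ∀ τ, a τ * (F τ σ - c) ^ 2 = a τ * (F τ σ - g σ) ^ 2
        + (2 * (g σ - c) * (a τ * F τ σ) + ((g σ - c) ^ 2 - 2 * (g σ - c) * g σ) * a τ) := by
      intro τ; ring
    rw [sum_congr rfl fun τ _ => e τ, sum_add_distrib, sum_add_distrib, ← mul_sum, ← mul_sum,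
      hgA, ← hA]
    ring
  have hfirst : ∀ σ, ∑ τ, a τ * (F τ σ - g σ) ^ 2 ≤ C * ∑ v ∈ S, energy a v (fun τ => F τ σ) := by
    intro σ
    obtain ⟨c, hc⟩ := hPa _ (hFσ σ)
    refine le_trans ?_ hc
    rw [hsplit σ c]
    exact le_add_of_nonneg_right (mul_nonneg (sq_nonneg _) hApos.le)
  obtain ⟨c, hc⟩ := hPb g hg
  refine ⟨c, ?_⟩
  have hES : ∀ v ∈ S, ∑ σ, b σ * energy a v (fun τ => F τ σ)
      = Fintype.card (V → Bool) * energy (fun σ => a σ * b σ) v f := by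
    intro v hv
    unfold energy
    rw [mul_left_comm, ← card_mul_sum_eq S, mul_sum]
    refine sum_congr rfl fun σ _ => ?_
    rw [mul_left_comm, mul_sum]
    congr 1
    refine sum_congr rfl fun τ _ => ?_
    rw [conductance_mul_right hb (hbflip v hv _), hbpw, ← flip_piecewise_of_mem hv]
    simp only [conductance, F, ← flip_piecewise_of_mem hv, hapw]
    ring
  have hES' : ∀ v ∈ S', ∑ τ, a τ * energy b v (F τ)
      = Fintype.card (V → Bool) * energy (fun σ => a σ * b σ) v f := by
    intro v hv
    unfold energy
    rw [mul_left_comm, ← card_mul_sum_eq S, sum_comm, mul_sum]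
    refine sum_congr rfl fun τ _ => ?_
    rw [mul_left_comm, mul_sum]
    congr 1
    refine sum_congr rfl fun σ _ => ?_
    have e : (fun σ => a σ * b σ) = fun σ => b σ * a σ := funext fun σ => mul_comm _ _
    rw [e, conductance_mul_right ha (haflip v hv _), hapw, ← flip_piecewise_of_notMem (hS' v hv)]
    simp only [conductance, F, ← flip_piecewise_of_notMem (hS' v hv), hbpw]
    ring
  have hJensen : ∀ v, A * energy b v g ≤ ∑ τ, a τ * energy b v (F τ) := by
    intro v
    unfold energy
    simp only [mul_left_comm _ (1 / 2 : ℝ), ← mul_sum]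
    gcongr
    simp only [mul_sum]
    rw [sum_comm]
    gcongr with σ
    have hcs := sq_sum_div_le_sum_sq_div univ
      (fun τ => a τ * (F τ (flip σ v) - F τ σ)) (g := a) fun τ _ => ha τ
    have e1 : ∀ τ, (a τ * (F τ (flip σ v) - F τ σ)) ^ 2 / a τ
        = a τ * (F τ (flip σ v) - F τ σ) ^ 2 := by
      intro τ
      have := (ha τ).ne'
      field_simp
    have e2 : g (flip σ v) - g σ = (∑ τ, a τ * (F τ (flip σ v) - F τ σ)) / A := by
      simp only [g, mul_sub, sum_sub_distrib, sub_div]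
    rw [sum_congr rfl fun τ _ => e1 τ, ← hA] at hcs
    rw [e2]
    calc A * (conductance b v σ * ((∑ τ, a τ * (F τ (flip σ v) - F τ σ)) / A) ^ 2)
        = conductance b v σ * ((∑ τ, a τ * (F τ (flip σ v) - F τ σ)) ^ 2 / A) := by
          field_simp
      _ ≤ conductance b v σ * ∑ τ, a τ * (F τ (flip σ v) - F τ σ) ^ 2 :=
          mul_le_mul_of_nonneg_left hcs (conductance_pos hb v σ).le
      _ = _ := by rw [mul_sum]; exact sum_congr rfl fun τ _ => by ring
  have hN : (0 : ℝ) < Fintype.card (V → Bool) := by exact_mod_cast Fintype.card_pos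
  refine le_of_mul_le_mul_left ?_ hN
  rw [← card_mul_sum_eq S]
  calc ∑ σ, ∑ τ, a (S.piecewise τ σ) * b (S.piecewise τ σ) * (f (S.piecewise τ σ) - c) ^ 2
      = ∑ σ, b σ * ∑ τ, a τ * (F τ σ - c) ^ 2 := by
        refine sum_congr rfl fun σ _ => ?_
        rw [mul_sum]
        refine sum_congr rfl fun τ _ => ?_
        rw [hapw, hbpw]
        ring
    _ = ∑ σ, b σ * ∑ τ, a τ * (F τ σ - g σ) ^ 2 + A * ∑ σ, b σ * (g σ - c) ^ 2 := by
        rw [mul_sum, ← sum_add_distrib]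
        refine sum_congr rfl fun σ _ => ?_
        rw [hsplit σ c]
        ring
    _ ≤ ∑ σ, b σ * (C * ∑ v ∈ S, energy a v (fun τ => F τ σ))
          + A * (C * ∑ v ∈ S', energy b v g) := by
        gcongr with σ
        · exact (hb σ).le
        · exact hfirst σ
    _ = C * ∑ v ∈ S, ∑ σ, b σ * energy a v (fun τ => F τ σ)
          + C * ∑ v ∈ S', A * energy b v g := by
        rw [sum_comm, mul_left_comm A, mul_sum (s := S')]
        simp only [mul_sum, mul_left_comm C]
    _ ≤ C * ∑ v ∈ S, ∑ σ, b σ * energy a v (fun τ => F τ σ)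
          + C * ∑ v ∈ S', ∑ τ, a τ * energy b v (F τ) := by
        gcongr with v
        exact hJensen v
    _ = _ := by
        rw [sum_congr rfl hES, sum_congr rfl hES', ← mul_sum, ← mul_sum, sum_union hd]
        ring

omit [Fintype V] [DecidableEq V] in
lemma abs_spin (b : Bool) : |spin b| = 1 := by
  cases b <;> simp [spin]

/-- The Hamiltonian, with the sign of the exponent of the Gibbs weight, of the Ising model
restricted to `S`. -/
noncomputable def blockEnergy (J : V → V → ℝ) (h : V → ℝ) (S : Finset V) (σ : V → Bool) : ℝ :=
  (1 / 2) * ∑ x ∈ S, ∑ y ∈ S, J x y * spin (σ x) * spin (σ y) + ∑ x ∈ S, h x * spin (σ x)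

/-- The Gibbs weight of the Ising model restricted to `S`. -/
noncomputable def blockWeight (J : V → V → ℝ) (h : V → ℝ) (S : Finset V) (σ : V → Bool) : ℝ :=
  Real.exp (blockEnergy J h S σ)

omit [Fintype V] [DecidableEq V] in
lemma blockWeight_pos (J : V → V → ℝ) (h : V → ℝ) (S : Finset V) (σ : V → Bool) :
    0 < blockWeight J h S σ := Real.exp_pos _

omit [Fintype V] [DecidableEq V] in
lemma dependsOn_blockWeight (J : V → V → ℝ) (h : V → ℝ) (S : Finset V) :
    DependsOn (blockWeight J h S) (S : Set V) := by
  intro σ τ hστ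
  have e : ∀ x ∈ S, spin (σ x) = spin (τ x) := fun x hx => by rw [hστ x (mem_coe.mpr hx)]
  unfold blockWeight blockEnergy
  rw [sum_congr rfl fun x hx => sum_congr rfl fun y hy => by rw [e x hx, e y hy],
    sum_congr (s₁ := S) (f := fun x => h x * spin (σ x)) rfl fun x hx => by rw [e x hx]]

omit [Fintype V] in
lemma blockEnergy_union {J : V → V → ℝ} (hsymm : ∀ x y, J x y = J y x) (h : V → ℝ)
    {S S' : Finset V} (hd : Disjoint S S') (σ : V → Bool) :
    blockEnergy J h (S ∪ S') σ = blockEnergy J h S σ + blockEnergy J h S' σ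
      + ∑ x ∈ S, ∑ y ∈ S', J x y * spin (σ x) * spin (σ y) := by
  have e : ∑ x ∈ S', ∑ y ∈ S, J x y * spin (σ x) * spin (σ y)
      = ∑ x ∈ S, ∑ y ∈ S', J x y * spin (σ x) * spin (σ y) := by
    rw [sum_comm]
    exact sum_congr rfl fun x _ => sum_congr rfl fun y _ => by rw [hsymm]; ring
  simp only [blockEnergy, sum_union hd, sum_add_distrib, e]
  ring

lemma Poincare.perturb_exp {H H' : (V → Bool) → ℝ} {S : Finset V} {C k : ℝ} (hC : 0 ≤ C)
    (hH : ∀ σ, |H σ - H' σ| ≤ k) (h : Poincare (fun σ => Real.exp (H σ)) S C) :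
    Poincare (fun σ => Real.exp (H' σ)) S (Real.exp (2 * k) * C) := by
  refine h.perturb (fun σ => Real.exp_pos _) (fun σ => Real.exp_pos _) hC ?_ ?_ <;> intro σ <;>
    rw [← Real.exp_add] <;> gcongr <;> linarith [abs_le.mp (hH σ)]

/-- Joining two blocks that interact through at most one edge. -/
lemma Poincare.blockWeight_union {J : V → V → ℝ} (hsymm : ∀ x y, J x y = J y x) {h : V → ℝ}
    {β : ℝ} (hJ : ∀ x y, |J x y| ≤ β) {S S' : Finset V} (hd : Disjoint S S') {u u' : V}
    (hu : u ∈ S) (hu' : u' ∈ S') (hcross : ∀ x ∈ S, ∀ y ∈ S', J x y ≠ 0 → x = u ∧ y = u')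
    {C : ℝ} (hC : 0 ≤ C) (hS : Poincare (blockWeight J h S) S C)
    (hS' : Poincare (blockWeight J h S') S' C) :
    Poincare (blockWeight J h (S ∪ S')) (S ∪ S') (Real.exp (2 * β) * C) := by
  have hmul := Poincare.mul (blockWeight_pos J h S) (blockWeight_pos J h S') hd
    (dependsOn_blockWeight J h S) (dependsOn_blockWeight J h S') hC hS hS'
  simp only [blockWeight, ← Real.exp_add] at hmul
  refine hmul.perturb_exp hC fun σ => ?_
  have hsum : ∑ x ∈ S, ∑ y ∈ S', J x y * spin (σ x) * spin (σ y)
      = J u u' * spin (σ u) * spin (σ u') := by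
    rw [sum_eq_single_of_mem u hu, sum_eq_single_of_mem u' hu']
    · intro y hy hne
      have : J u y = 0 := by
        by_contra h0
        exact hne (hcross u hu y hy h0).2
      simp [this]
    · intro x hx hne
      refine sum_eq_zero fun y hy => ?_
      have : J x y = 0 := by
        by_contra h0
        exact hne (hcross x hx y hy h0).1
      simp [this]
  rw [blockEnergy_union hsymm h hd, hsum, sub_add_cancel_left, abs_neg, abs_mul, abs_mul, abs_spin,
    abs_spin, mul_one, mul_one]
  exact hJ u u'

section Forest

variable {r : V → V → Prop} {depth : V → ℕ}

omit [DecidableEq V] [Fintype V] in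
lemma depth_le_of_reflTransGen (hdepth : ∀ v c, r v c → depth v < depth c) {v x : V}
    (h : ReflTransGen r v x) : depth v ≤ depth x := by
  induction h with
  | refl => exact le_rfl
  | tail _ hbc ih => exact ih.trans (hdepth _ _ hbc).le

omit [DecidableEq V] [Fintype V] in
lemma eq_of_common_descendant (hdepth : ∀ v c, r v c → depth v < depth c)
    (huniq : ∀ a b c, r a c → r b c → a = b) {v c c' x : V} (hc : r v c) (hc' : r v c')
    (hx : ReflTransGen r c x) (hx' : ReflTransGen r c' x) : c = c' := by
  have key : ∀ {c c' : V}, r v c → r v c' → ReflTransGen r c' c → c = c' := by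
    intro c c' hc hc' h
    rcases h.cases_tail with h | ⟨b, hb, hbc⟩
    · exact h
    · obtain rfl := huniq _ _ _ hc hbc
      exact absurd (depth_le_of_reflTransGen hdepth hb) (not_le.mpr (hdepth _ _ hc'))
  have hU : Relator.RightUnique (Function.swap r) := fun a b c hb hc => huniq _ _ _ hb hc
  rcases ReflTransGen.total_of_right_unique hU (reflTransGen_swap.mpr hx)
    (reflTransGen_swap.mpr hx') with h | h
  · exact key hc hc' (reflTransGen_swap.mp h)
  · exact (key hc' hc (reflTransGen_swap.mp h)).symm

open Classical in
/-- The Poincaré inequality for the Ising model on the descendants of a vertex `v` of a rooted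
forest with child relation `r`, where the potential `B` decreases from each vertex to its children
by at least the number of children. -/
lemma poincare_descendants (hdepth : ∀ v c, r v c → depth v < depth c)
    (huniq : ∀ a b c, r a c → r b c → a = b) {J : V → V → ℝ} (hsymm : ∀ x y, J x y = J y x)
    (h : V → ℝ) {β : ℝ} (hβ : 0 ≤ β) (hJ : ∀ x y, |J x y| ≤ β)
    (hsupp : ∀ x y, J x y ≠ 0 → r x y ∨ r y x) {B : V → ℝ} (hB : ∀ v, 0 ≤ B v)
    (hBr : ∀ v c, r v c → B c + #{x | r v x} ≤ B v) (v : V) :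
    Poincare (blockWeight J h ({x | ReflTransGen r v x} : Finset V))
      ({x | ReflTransGen r v x} : Finset V) (Real.exp (2 * β * B v)) := by
  set D : V → Finset V := fun v => {x | ReflTransGen r v x} with hD
  have memD : ∀ {v x}, x ∈ D v ↔ ReflTransGen r v x := by simp [hD]
  change Poincare (blockWeight J h (D v)) (D v) _
  induction hn : #(D v) using Nat.strong_induction_on generalizing v with
  | _ n ih =>
  subst hn
  have hnot : ∀ c, r v c → v ∉ D c := fun c hc hv =>
    absurd (depth_le_of_reflTransGen hdepth (memD.mp hv)) (not_le.mpr (hdepth _ _ hc))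
  have hlt : ∀ c, r v c → #(D c) < #(D v) := fun c hc => card_lt_card <|
    (ssubset_iff_of_subset fun x hx => memD.mpr (.head hc (memD.mp hx))).mpr
      ⟨v, memD.mpr .refl, hnot c hc⟩
  set ch : Finset V := {x | r v x} with hch
  have memch : ∀ {c}, c ∈ ch ↔ r v c := by simp [hch]
  set b := B v - #ch with hb
  have hb0 : 0 ≤ b := by
    rcases ch.eq_empty_or_nonempty with h0 | ⟨c, hc⟩
    · simpa [hb, h0] using hB v
    · linarith [hBr v c (memch.mp hc), hB c]
  have main : ∀ K ⊆ ch, Poincare (blockWeight J h ({v} ∪ K.biUnion D)) ({v} ∪ K.biUnion D)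
      (Real.exp (2 * β * (#K + b))) := by
    intro K
    induction K using Finset.induction_on with
    | empty =>
      intro _
      have h1 := poincare_singleton (blockWeight_pos J h {v}) v
        (by simpa using dependsOn_blockWeight J h {v})
      simpa using h1.mono (blockWeight_pos J h {v})
        (Real.one_le_exp (by positivity : 0 ≤ 2 * β * b))
    | insert c K hcK ihK =>
      intro hK
      have hc : r v c := memch.mp (hK (mem_insert_self c K))
      have hKch : K ⊆ ch := (subset_insert c K).trans hK
      have hdisj : ∀ c' ∈ K, ∀ x, x ∈ D c' → x ∉ D c := by
        intro c' hc' x hx' hx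
        have := eq_of_common_descendant hdepth huniq hc (memch.mp (hKch hc')) (memD.mp hx)
          (memD.mp hx')
        exact hcK (this ▸ hc')
      have hunion : {v} ∪ (insert c K).biUnion D = ({v} ∪ K.biUnion D) ∪ D c := by
        rw [biUnion_insert, union_assoc, union_comm (D c)]
      have hd : Disjoint ({v} ∪ K.biUnion D) (D c) := by
        rw [disjoint_left]
        intro x hx
        rcases mem_union.mp hx with hx | hx
        · rw [mem_singleton.mp hx]
          exact hnot c hc
        · obtain ⟨c', hc', hx⟩ := mem_biUnion.mp hx
          exact hdisj c' hc' x hx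
      have hconst : Real.exp (2 * β * (#(insert c K) + b))
          = Real.exp (2 * β) * Real.exp (2 * β * (#K + b)) := by
        rw [card_insert_of_notMem hcK, ← Real.exp_add]
        push_cast
        ring_nf
      have hBc : B c ≤ #K + b := by
        have := hBr v c hc
        have : (0 : ℝ) ≤ #K := by positivity
        linarith
      rw [hunion, hconst]
      refine Poincare.blockWeight_union hsymm hJ hd (u := v) (u' := c) (by simp) (memD.mpr .refl)
        ?_ (Real.exp_pos _).le (ihK hKch) ((ih _ (hlt c hc) c rfl).mono (blockWeight_pos J h _) ?_)
      · intro x hx y hy hxy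
        rcases mem_union.mp hx with hx | hx
        · rw [mem_singleton] at hx
          subst hx
          refine ⟨rfl, ?_⟩
          rcases hsupp _ _ hxy with hr | hr
          · rcases (memD.mp hy).cases_tail with hyc | ⟨b, hcb, hby⟩
            · exact hyc
            · obtain rfl := huniq _ _ _ hr hby
              exact absurd (memD.mpr hcb) (hnot c hc)
          · have h1 := depth_le_of_reflTransGen hdepth (memD.mp hy)
            have h2 := hdepth _ _ hr
            have h3 := hdepth _ _ hc
            omega
        · obtain ⟨c', hc', hx⟩ := mem_biUnion.mp hx
          exfalso
          rcases hsupp _ _ hxy with hr | hr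
          · exact hdisj c' hc' y (memD.mpr ((memD.mp hx).tail hr)) hy
          · exact hdisj c' hc' x hx (memD.mpr ((memD.mp hy).tail hr))
      · gcongr
  have hDv : D v = {v} ∪ ch.biUnion D := by
    ext x
    simp only [mem_union, mem_singleton, mem_biUnion, memD, memch]
    rw [ReflTransGen.cases_head_iff, eq_comm]
  have hfin := main ch subset_rfl
  rwa [← hDv, show (#ch : ℝ) + b = B v by rw [hb]; ring] at hfin

end Forest

/-- The Poincaré inequality for the Ising model on a tree whose paths from the root have degree
sum at most `m`. -/
lemma poincare_tree {T : SimpleGraph V} [DecidableRel T.Adj] (hT : T.IsTree) (root : V)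
    {J : V → V → ℝ} (hsymm : ∀ x y, J x y = J y x) (h : V → ℝ) {β : ℝ} (hβ : 0 ≤ β)
    (hJ : ∀ x y, |J x y| ≤ β) (hsupp : ∀ x y, ¬ T.Adj x y → J x y = 0) {m : ℕ}
    (hm : ∀ (u : V) (p : T.Walk root u), p.IsPath →
      (p.support.map (fun x => T.degree x)).sum ≤ m) :
    Poincare (blockWeight J h univ) univ (Real.exp (2 * β * m)) := by
  classical
  choose p hp hpu using hT.existsUnique_path root
  let r : V → V → Prop := fun v c => T.Adj v c ∧ c ∉ (p v).support
  have hconcat : ∀ {v c}, (hr : r v c) → p c = (p v).concat hr.1 := fun hr =>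
    (hpu _ _ ((hp _).concat hr.2 hr.1)).symm
  have hdepth : ∀ v c, r v c → (p v).length < (p c).length := by
    intro v c hr
    rw [hconcat hr, SimpleGraph.Walk.length_concat]
    exact Nat.lt_succ_self _
  have huniq : ∀ a b c, r a c → r b c → a = b := by
    intro a b c ha hb
    have e := congrArg SimpleGraph.Walk.penultimate ((hconcat ha).symm.trans (hconcat hb))
    simpa using e
  have hadj : ∀ x y, T.Adj x y → r x y ∨ r y x := by
    intro x y hxy
    by_cases hy : y ∈ (p x).support
    · exact .inr ⟨hxy.symm,
        hT.isAcyclic.ne_mem_support_of_support_of_adj_of_isPath (hp x) (hp y) hxy hy⟩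
    · exact .inl ⟨hxy, hy⟩
  have hroot : ∀ x, ReflTransGen r root x := by
    have step : ∀ x y, T.Adj x y → ReflTransGen r root x → ReflTransGen r root y := by
      intro x y hxy hx
      rcases hadj x y hxy with hr | hr
      · exact hx.tail hr
      · rcases hx.cases_tail with rfl | ⟨b, hb, hbx⟩
        · exact absurd (SimpleGraph.Walk.start_mem_support _) hr.2
        · rwa [huniq _ _ _ hr hbx]
    intro x
    obtain ⟨q⟩ := hT.connected root x
    have walk : ∀ {a b : V}, T.Walk a b → ReflTransGen r root a → ReflTransGen r root b := by
      intro a b q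
      induction q with
      | nil => exact id
      | cons hab _ ih => exact fun ha => ih (step _ _ hab ha)
    exact walk q .refl
  let W : V → ℕ := fun v => ((p v).support.map (fun x => T.degree x)).sum
  have hW : ∀ v, W v ≤ m := fun v => hm v _ (hp v)
  have hWr : ∀ v c, r v c → W c = W v + T.degree c := by
    intro v c hr
    simp only [W, hconcat hr, SimpleGraph.Walk.support_concat, List.map_append, List.sum_append]
    simp
  have hWroot : W root = T.degree root := by
    simp [W, ← hpu root _ SimpleGraph.Walk.IsPath.nil]
  have hP := poincare_descendants hdepth huniq hsymm h hβ hJ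
    (fun x y hxy => hadj x y (by_contra fun hn => hxy (hsupp x y hn)))
    (B := fun v => (m : ℝ) - W v + T.degree v)
    (fun v => by
      have : (W v : ℝ) ≤ m := by exact_mod_cast hW v
      have : (0 : ℝ) ≤ T.degree v := by positivity
      linarith)
    (fun v c hr => by
      have h1 : (W c : ℝ) = W v + T.degree c := by exact_mod_cast hWr v c hr
      have h2 : ∀ K : Finset V, (∀ x ∈ K, r v x) → (#K : ℝ) ≤ T.degree v := fun K hK => by
        rw [← SimpleGraph.card_neighborFinset_eq_degree]
        exact_mod_cast card_le_card fun x hx => by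
          rw [SimpleGraph.mem_neighborFinset]
          exact (hK x hx).1
      refine (add_le_add le_rfl (h2 _ fun x hx => ?_)).trans (by linarith)
      simpa only [mem_filter, mem_univ, true_and] using hx) root
  have huniv : ({x | ReflTransGen r root x} : Finset V) = univ := by
    ext x
    simp [hroot x]
  rw [huniv] at hP
  simpa [hWroot] using hP

omit [DecidableEq V] in
lemma sum_adj_eq_two_mul_card_edgeFinset (G : SimpleGraph V) [DecidableRel G.Adj] :
    ∑ x : V, ∑ y : V, (if G.Adj x y then (1 : ℝ) else 0) = 2 * #G.edgeFinset := by
  have := G.sum_degrees_eq_twice_card_edges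
  simp only [← SimpleGraph.card_neighborFinset_eq_degree,
    SimpleGraph.neighborFinset_eq_filter] at this
  simp only [sum_boole]
  exact_mod_cast this

/-- Passing from a spanning tree `T` to `G` multiplies the Poincaré constant by at most
`exp (2 * β * s)`, where `s` is the number of additional edges. -/
lemma poincare_graph {G T : SimpleGraph V} [DecidableRel G.Adj] [DecidableRel T.Adj]
    (hTG : T ≤ G) (hT : T.IsTree) (root : V)
    {s : ℕ} (hedges : #G.edgeFinset = Fintype.card V + s - 1)
    {J : V → V → ℝ} (h : V → ℝ) {β : ℝ} (hβ : 0 ≤ β) (hsymm : ∀ x y, J x y = J y x)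
    (hJ : ∀ x y, |J x y| ≤ β) (hsupp : ∀ x y, ¬ G.Adj x y → J x y = 0) {m : ℕ}
    (hm : ∀ (u : V) (p : T.Walk root u), p.IsPath →
      (p.support.map (fun x => T.degree x)).sum ≤ m) :
    Poincare (blockWeight J h univ) univ (Real.exp (2 * β * (m + s))) := by
  let JT : V → V → ℝ := fun x y => if T.Adj x y then J x y else 0
  have hJT := poincare_tree hT root (J := JT)
    (fun x y => by simp only [JT, T.adj_comm x y, hsymm x y]) h hβ
    (fun x y => by
      by_cases hxy : T.Adj x y
      · simpa [JT, hxy] using hJ x y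
      · simpa [JT, hxy] using hβ)
    (fun x y hxy => by simp [JT, hxy]) hm
  have hcard : (#G.edgeFinset : ℝ) = #T.edgeFinset + s := by
    have := hT.card_edgeFinset
    have : #G.edgeFinset = #T.edgeFinset + s := by omega
    exact_mod_cast this
  have hdiff : ∀ σ, |blockEnergy JT h univ σ - blockEnergy J h univ σ| ≤ β * s := by
    intro σ
    have e : blockEnergy JT h univ σ - blockEnergy J h univ σ
        = (1 / 2) * ∑ x, ∑ y, (JT x y - J x y) * spin (σ x) * spin (σ y) := by
      simp only [blockEnergy, sub_mul, sum_sub_distrib]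
      ring
    have hterm : ∀ x y, |(JT x y - J x y) * spin (σ x) * spin (σ y)|
        ≤ β * ((if G.Adj x y then 1 else 0) - (if T.Adj x y then 1 else 0)) := by
      intro x y
      rw [abs_mul, abs_mul, abs_spin, abs_spin, mul_one, mul_one]
      by_cases hT' : T.Adj x y
      · simp [JT, hT', hTG hT']
      · by_cases hG : G.Adj x y
        · simpa [JT, hT', hG] using hJ x y
        · simp [JT, hT', hG, hsupp x y hG]
    rw [e, abs_mul, abs_of_pos (one_half_pos (α := ℝ))]
    calc (1 / 2) * |∑ x, ∑ y, (JT x y - J x y) * spin (σ x) * spin (σ y)|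
        ≤ (1 / 2) * ∑ x, ∑ y, β * ((if G.Adj x y then 1 else 0) - (if T.Adj x y then 1 else 0)) := by
          refine mul_le_mul_of_nonneg_left ?_ one_half_pos.le
          exact (abs_sum_le_sum_abs _ _).trans (sum_le_sum fun x _ =>
            (abs_sum_le_sum_abs _ _).trans (sum_le_sum fun y _ => hterm x y))
      _ = β * s := by
          simp only [← mul_sum, sum_sub_distrib, sum_adj_eq_two_mul_card_edgeFinset, hcard]
          ring
  have hP := Poincare.perturb_exp (Real.exp_pos _).le hdiff hJT
  rwa [← Real.exp_add, show 2 * (β * s) + 2 * β * m = 2 * β * (m + s) by ring] at hP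

/-- The Poincaré inequality bounds the variance under the normalized weight. -/
lemma Poincare.variance_le {a : (V → Bool) → ℝ} (ha : ∀ σ, 0 < a σ) {C : ℝ}
    (h : Poincare a univ C) (f : (V → Bool) → ℝ) :
    (∑ σ, a σ / (∑ τ, a τ) * f σ ^ 2) - (∑ σ, a σ / (∑ τ, a τ) * f σ) ^ 2
      ≤ C * ((1 / 2) * ∑ σ, ∑ v, a σ / (∑ τ, a τ) * (a (flip σ v) / (a σ + a (flip σ v)))
        * (f (flip σ v) - f σ) ^ 2) := by
  obtain ⟨c, hc⟩ := h f (by rw [coe_univ]; exact dependsOn_univ f)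
  set Z := ∑ τ, a τ with hZ
  have hZpos : 0 < Z := sum_pos (fun σ _ => ha σ) univ_nonempty
  have hvar : (∑ σ, a σ / Z * f σ ^ 2) - (∑ σ, a σ / Z * f σ) ^ 2
      ≤ (∑ σ, a σ * (f σ - c) ^ 2) / Z := by
    have e : (∑ σ, a σ * (f σ - c) ^ 2) / Z
        = (∑ σ, a σ / Z * f σ ^ 2) - 2 * c * (∑ σ, a σ / Z * f σ) + c ^ 2 * (∑ σ, a σ / Z) := by
      rw [sum_div, mul_sum, mul_sum, ← sum_sub_distrib, ← sum_add_distrib]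
      exact sum_congr rfl fun σ _ => by ring
    rw [e, ← sum_div, ← hZ, div_self hZpos.ne']
    nlinarith [sq_nonneg ((∑ σ, a σ / Z * f σ) - c)]
  have hdir : (∑ v, energy a v f) / Z = (1 / 2) * ∑ σ, ∑ v, a σ / Z *
      (a (flip σ v) / (a σ + a (flip σ v))) * (f (flip σ v) - f σ) ^ 2 := by
    simp only [energy, conductance]
    rw [← mul_sum, mul_div_assoc, sum_comm, sum_div]
    congr 1
    refine sum_congr rfl fun σ _ => ?_
    rw [sum_div]
    exact sum_congr rfl fun v _ => by ring
  rw [← hdir, ← mul_div_assoc]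
  exact hvar.trans (by gcongr)

end Glauber

/-- Let `G` be a graph on `r` vertices with `r + s − 1` edges having a
spanning tree `T` in which every simple path from the root has vertex-degree sum at
most `m`.  Then the relaxation time of the continuous-time heat-bath Gibbs sampler for
the Ising model on `G` (interactions `0 ≤ J ≤ β`, arbitrary external fields, boundary
conditions encoded by the fields) is at most `exp(4β(m+s))`.  Variationally:
`Var_P(f) ≤ exp(4β(m+s)) · E(f,f)` for every observable `f`. -/
theorem stmt11 {V : Type} [Fintype V] [DecidableEq V]
    (G T : SimpleGraph V) [DecidableRel G.Adj] [DecidableRel T.Adj]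
    (hTG : T ≤ G) (hT : T.IsTree) (root : V)
    (s : ℕ) (hedges : G.edgeFinset.card = Fintype.card V + s - 1)
    (J : V → V → ℝ) (h : V → ℝ) (β : ℝ) (hβ : 0 ≤ β)
    (hsymm : ∀ u w, J u w = J w u)
    (hsupp : ∀ u w, ¬ G.Adj u w → J u w = 0)
    (hJ : ∀ u w, 0 ≤ J u w ∧ J u w ≤ β)
    (m : ℕ)
    (hm : ∀ (u : V) (p : T.Walk root u), p.IsPath →
      (p.support.map (fun x => T.degree x)).sum ≤ m) :
    let w : (V → Bool) → ℝ := fun σ =>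
      Real.exp ((1 / 2) * ∑ u : V, ∑ x : V, J u x * spin (σ u) * spin (σ x)
        + ∑ u : V, h u * spin (σ u))
    let P : (V → Bool) → ℝ := fun σ => w σ / ∑ σ' : V → Bool, w σ'
    let flip : (V → Bool) → V → (V → Bool) := fun σ v => Function.update σ v (! σ v)
    let rate : (V → Bool) → V → ℝ := fun σ v => w (flip σ v) / (w σ + w (flip σ v))
    let dirichlet : ((V → Bool) → ℝ) → ℝ := fun f =>
      (1 / 2) * ∑ σ : V → Bool, ∑ v : V, P σ * rate σ v * (f (flip σ v) - f σ) ^ 2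
    let variance : ((V → Bool) → ℝ) → ℝ := fun f =>
      (∑ σ : V → Bool, P σ * (f σ) ^ 2) - (∑ σ : V → Bool, P σ * f σ) ^ 2
    ∀ f : (V → Bool) → ℝ,
      variance f ≤ Real.exp (4 * β * (m + s)) * dirichlet f := by
  intro w P flip rate dirichlet variance f
  have hJabs : ∀ x y, |J x y| ≤ β := fun x y => by
    rw [abs_of_nonneg (hJ x y).1]
    exact (hJ x y).2
  have hP := Glauber.poincare_graph hTG hT root hedges h hβ hsymm hJabs hsupp hm
  have hle : Real.exp (2 * β * (m + s)) ≤ Real.exp (4 * β * (m + s)) := by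
    gcongr
    norm_num
  exact (hP.mono (Glauber.blockWeight_pos J h _) hle).variance_le
    (Glauber.blockWeight_pos J h _) f
end

section
/- Let T be a finite tree and consider the continuous-time Gibbs sampler for the Ising model on T with interactions 0 ≤ β_{u,v} ≤ β, arbitrary boundary conditions and external fields. If m(T) denotes the maximum over all simple paths Γ starting at the root of Σ_{v∈Γ} deg(v), then the relaxation time τ satisfies τ ≤ exp(4β m(T)). -/
section BlockVariance

variable {V : Type} [DecidableEq V]

/-- `g` does not depend on the coordinates in `S`. -/
def IgnoresOn (S : Finset V) (g : (V → Bool) → ℝ) : Prop :=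
  ∀ σ τ, g (S.piecewise τ σ) = g σ

lemma piecewise_piecewise_comm {S T : Finset V} (hST : Disjoint S T) (σ τ ρ : V → Bool) :
    S.piecewise τ (T.piecewise ρ σ) = T.piecewise ρ (S.piecewise τ σ) := by
  funext x
  have : x ∈ S → x ∉ T := fun hx => Finset.disjoint_left.1 hST hx
  by_cases h1 : x ∈ S <;> by_cases h2 : x ∈ T <;> simp_all [Finset.piecewise]

lemma piecewise_swap_swap (S : Finset V) (σ τ : V → Bool) :
    S.piecewise (S.piecewise σ τ) (S.piecewise τ σ) = σ := by
  funext x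
  by_cases h : x ∈ S <;> simp [Finset.piecewise, h]

lemma IgnoresOn.union {S T : Finset V} {g : (V → Bool) → ℝ}
    (hS : IgnoresOn S g) (hT : IgnoresOn T g) : IgnoresOn (S ∪ T) g := by
  intro σ τ
  have : (S ∪ T).piecewise τ σ = S.piecewise τ (T.piecewise τ σ) := by
    funext x
    by_cases h1 : x ∈ S <;> by_cases h2 : x ∈ T <;> simp [Finset.piecewise, h1, h2]
  rw [this, hS, hT]

variable [Fintype V]

/-- Conditional expectation of `f` given the spins outside `S`, under the measure proportional
to `w`. -/
noncomputable def blockMean (w : (V → Bool) → ℝ) (S : Finset V) (f : (V → Bool) → ℝ)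
    (σ : V → Bool) : ℝ :=
  (∑ τ : V → Bool, w (S.piecewise τ σ) * f (S.piecewise τ σ)) /
    ∑ τ : V → Bool, w (S.piecewise τ σ)

/-- The (unnormalised) expected conditional variance of `f` given the spins outside `S`. -/
noncomputable def blockVar (w : (V → Bool) → ℝ) (S : Finset V) (f : (V → Bool) → ℝ) : ℝ :=
  ∑ σ : V → Bool, w σ * (f σ - blockMean w S f σ) ^ 2

lemma blockMean_ignoresOn (w : (V → Bool) → ℝ) (S : Finset V) (f : (V → Bool) → ℝ) :
    IgnoresOn S (blockMean w S f) := by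
  intro σ τ
  simp [blockMean]

lemma blockMean_sub (w : (V → Bool) → ℝ) (S : Finset V) (f g : (V → Bool) → ℝ) (σ : V → Bool) :
    blockMean w S (fun σ => f σ - g σ) σ = blockMean w S f σ - blockMean w S g σ := by
  simp [blockMean, mul_sub, sub_div]

lemma sum_sum_piecewise_swap (S : Finset V) (F : (V → Bool) → (V → Bool) → ℝ) :
    ∑ σ : V → Bool, ∑ τ : V → Bool, F σ τ =
      ∑ σ : V → Bool, ∑ τ : V → Bool, F (S.piecewise τ σ) (S.piecewise σ τ) := by
  have inv := piecewise_swap_swap S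
  rw [← Fintype.sum_prod_type', ← Fintype.sum_prod_type']
  refine Fintype.sum_equiv
    ⟨fun p => (S.piecewise p.2 p.1, S.piecewise p.1 p.2),
      fun p => (S.piecewise p.2 p.1, S.piecewise p.1 p.2),
      fun p => by simp [inv],
      fun p => by simp [inv]⟩ _ _ ?_
  rintro ⟨σ, τ⟩
  simp [inv]

lemma sum_mul_blockMean {w : (V → Bool) → ℝ} (hw : ∀ σ, 0 < w σ) {S : Finset V}
    {g : (V → Bool) → ℝ} (hg : IgnoresOn S g) (f : (V → Bool) → ℝ) :
    ∑ σ, w σ * g σ * blockMean w S f σ = ∑ σ, w σ * g σ * f σ := by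
  simp only [blockMean, Finset.sum_div, Finset.mul_sum]
  rw [sum_sum_piecewise_swap S]
  refine Finset.sum_congr rfl fun σ _ => ?_
  have inv := piecewise_swap_swap S
  have hW : 0 < ∑ τ : V → Bool, w (S.piecewise τ σ) :=
    Finset.sum_pos (fun _ _ => hw _) Finset.univ_nonempty
  simp only [inv, hg σ, Finset.piecewise_idem_right]
  rw [Finset.sum_congr rfl (g := fun τ => w (S.piecewise τ σ) *
    (g σ * (w σ * f σ / ∑ τ : V → Bool, w (S.piecewise τ σ)))) fun τ _ => by ring,
    ← Finset.sum_mul]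
  field_simp

lemma sum_sq_sub_eq {w : (V → Bool) → ℝ} (hw : ∀ σ, 0 < w σ) {S : Finset V}
    {g : (V → Bool) → ℝ} (hg : IgnoresOn S g) (f : (V → Bool) → ℝ) :
    ∑ σ, w σ * (f σ - g σ) ^ 2 =
      blockVar w S f + ∑ σ, w σ * (blockMean w S f σ - g σ) ^ 2 := by
  have h1 := sum_mul_blockMean hw (blockMean_ignoresOn w S f) f
  have h2 := sum_mul_blockMean hw hg f
  rw [← sub_eq_zero, ← Finset.sum_sub_distrib] at h1 h2
  rw [blockVar, ← Finset.sum_add_distrib, ← sub_eq_zero, ← Finset.sum_sub_distrib]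
  have h3 : ∑ σ, (2 * (w σ * g σ * blockMean w S f σ - w σ * g σ * f σ) -
      2 * (w σ * blockMean w S f σ * blockMean w S f σ - w σ * blockMean w S f σ * f σ)) = 0 := by
    rw [Finset.sum_sub_distrib, ← Finset.mul_sum, ← Finset.mul_sum, h1, h2]
    simp
  rw [← h3]
  exact Finset.sum_congr rfl fun σ _ => by ring

lemma blockVar_nonneg {w : (V → Bool) → ℝ} (hw : ∀ σ, 0 < w σ) (S : Finset V)
    (f : (V → Bool) → ℝ) : 0 ≤ blockVar w S f :=
  Finset.sum_nonneg fun σ _ => mul_nonneg (hw σ).le (sq_nonneg _)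

lemma blockVar_le_sum_sq_sub {w : (V → Bool) → ℝ} (hw : ∀ σ, 0 < w σ) {S : Finset V}
    {g : (V → Bool) → ℝ} (hg : IgnoresOn S g) (f : (V → Bool) → ℝ) :
    blockVar w S f ≤ ∑ σ, w σ * (f σ - g σ) ^ 2 := by
  rw [sum_sq_sub_eq hw hg]
  exact le_add_of_nonneg_right (Finset.sum_nonneg fun σ _ => mul_nonneg (hw σ).le (sq_nonneg _))

lemma sum_sq_blockMean_le {w : (V → Bool) → ℝ} (hw : ∀ σ, 0 < w σ) (S : Finset V)
    (f : (V → Bool) → ℝ) :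
    ∑ σ, w σ * blockMean w S f σ ^ 2 ≤ ∑ σ, w σ * f σ ^ 2 := by
  have h := sum_sq_sub_eq hw (S := S) (g := fun _ => 0) (fun _ _ => rfl) f
  simp only [sub_zero] at h
  linarith [blockVar_nonneg hw S f]

lemma blockVar_mono {w w' : (V → Bool) → ℝ} (hw : ∀ σ, 0 < w σ) {b : ℝ}
    (hb : ∀ σ, w σ ≤ b * w' σ) (S : Finset V) (f : (V → Bool) → ℝ) :
    blockVar w S f ≤ b * blockVar w' S f := by
  refine (blockVar_le_sum_sq_sub hw (blockMean_ignoresOn w' S f) f).trans ?_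
  rw [blockVar, Finset.mul_sum]
  refine Finset.sum_le_sum fun σ _ => ?_
  rw [← mul_assoc]
  exact mul_le_mul_of_nonneg_right (hb σ) (sq_nonneg _)

lemma blockMean_ignoresOn_of_factor {w A B : (V → Bool) → ℝ} (hw : ∀ σ, 0 < w σ)
    {S T : Finset V} (hST : Disjoint S T) (hAB : ∀ σ, w σ = A σ * B σ)
    (hA : IgnoresOn T A) (hB : IgnoresOn S B) {g : (V → Bool) → ℝ} (hg : IgnoresOn T g) :
    IgnoresOn T (blockMean w S g) := by
  have key : ∀ σ, blockMean w S g σ =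
      (∑ τ : V → Bool, A (S.piecewise τ σ) * g (S.piecewise τ σ)) /
        ∑ τ : V → Bool, A (S.piecewise τ σ) := by
    intro σ
    have hB0 : B σ ≠ 0 := fun h0 => by simpa [hAB, h0] using hw σ
    rw [← mul_div_mul_right _ _ hB0, blockMean]
    simp only [hAB, hB σ, Finset.sum_mul]
    congr 1
    exact Finset.sum_congr rfl fun τ _ => by ring
  intro σ ρ
  simp only [key, piecewise_piecewise_comm hST, hA _ ρ, hg _ ρ]

/-- Tensorisation of the variance over two conditionally independent blocks. -/
lemma blockVar_union_le {w A B : (V → Bool) → ℝ} (hw : ∀ σ, 0 < w σ)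
    {S T : Finset V} (hST : Disjoint S T) (hAB : ∀ σ, w σ = A σ * B σ)
    (hA : IgnoresOn T A) (hB : IgnoresOn S B) (f : (V → Bool) → ℝ) :
    blockVar w (S ∪ T) f ≤ blockVar w S f + blockVar w T f := by
  have hg := blockMean_ignoresOn w S (blockMean w T f)
  refine (blockVar_le_sum_sq_sub hw (hg.union (blockMean_ignoresOn_of_factor hw hST hAB hA hB
    (blockMean_ignoresOn w T f))) f).trans ?_
  rw [sum_sq_sub_eq hw hg]
  gcongr
  simp only [← blockMean_sub]
  exact sum_sq_blockMean_le hw S _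

lemma blockVar_singleton_le {w : (V → Bool) → ℝ} (hw : ∀ σ, 0 < w σ) (v : V)
    (f : (V → Bool) → ℝ) :
    blockVar w {v} f ≤ (1 / 2) * ∑ σ : V → Bool,
      w σ * (w (Function.update σ v (! σ v)) / (w σ + w (Function.update σ v (! σ v)))) *
        (f (Function.update σ v (! σ v)) - f σ) ^ 2 := by
  set F : (V → Bool) → (V → Bool) := fun σ => Function.update σ v (! σ v) with hF
  have hFF : Function.Involutive F := fun σ => by simp [hF]
  set g : (V → Bool) → ℝ := fun σ => (w σ * f σ + w (F σ) * f (F σ)) / (w σ + w (F σ)) with hgdef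
  have hgF : ∀ σ, g (F σ) = g σ := fun σ => by
    simp only [hgdef, hFF σ]
    rw [add_comm, add_comm (w (F σ))]
  have hg : IgnoresOn {v} g := by
    intro σ τ
    rw [Finset.piecewise_singleton]
    by_cases h : τ v = σ v
    · rw [h, Function.update_eq_self]
    · rw [show τ v = ! σ v from by revert h; cases τ v <;> cases σ v <;> simp]
      exact hgF σ
  refine (blockVar_le_sum_sq_sub hw hg f).trans (le_of_eq ?_)
  have h2 : ∑ σ, w σ * (f σ - g σ) ^ 2 = ∑ σ, w (F σ) * (f (F σ) - g (F σ)) ^ 2 :=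
    (Equiv.sum_comp hFF.toPerm fun σ => w σ * (f σ - g σ) ^ 2).symm
  have h3 : ∑ σ, w σ * (f σ - g σ) ^ 2 =
      (1 / 2) * ∑ σ, (w σ * (f σ - g σ) ^ 2 + w (F σ) * (f (F σ) - g (F σ)) ^ 2) := by
    rw [Finset.sum_add_distrib, ← h2]
    ring
  rw [h3]
  congr 1
  refine Finset.sum_congr rfl fun σ _ => ?_
  rw [hgF]
  have h4 : w σ + w (F σ) ≠ 0 := (add_pos (hw _) (hw _)).ne'
  simp only [hgdef]
  change _ = w σ * (w (F σ) / (w σ + w (F σ))) * (f (F σ) - f σ) ^ 2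
  field_simp
  ring

end BlockVariance

section Ising

variable {V : Type} [Fintype V]

/-- The unnormalised Ising weight with couplings `J` and external fields `h`. -/
noncomputable def isingWeight (J : V → V → ℝ) (h : V → ℝ) (σ : V → Bool) : ℝ :=
  Real.exp ((1 / 2) * ∑ u : V, ∑ x : V, J u x * spin (σ u) * spin (σ x)
    + ∑ u : V, h u * spin (σ u))

lemma abs_spin (b : Bool) : |spin b| = 1 := by
  cases b <;> simp [spin]

lemma isingWeight_le {J J' : V → V → ℝ} (h : V → ℝ) {c : ℝ}
    (hc : ∑ u, ∑ x, |J u x - J' u x| ≤ 2 * c) (σ : V → Bool) :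
    isingWeight J h σ ≤ Real.exp c * isingWeight J' h σ := by
  rw [isingWeight, isingWeight, ← Real.exp_add, Real.exp_le_exp]
  have : ∑ u, ∑ x, J u x * spin (σ u) * spin (σ x) -
      ∑ u, ∑ x, J' u x * spin (σ u) * spin (σ x) ≤ ∑ u, ∑ x, |J u x - J' u x| := by
    simp only [← Finset.sum_sub_distrib]
    refine Finset.sum_le_sum fun u _ => Finset.sum_le_sum fun x _ => ?_
    rw [← sub_mul, ← sub_mul]
    refine (le_abs_self _).trans (le_of_eq ?_)
    rw [abs_mul, abs_mul, abs_spin, abs_spin, mul_one, mul_one]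
  linarith

variable [DecidableEq V]

lemma isingWeight_blockVar_union_le {J : V → V → ℝ} (h : V → ℝ) {S T : Finset V}
    (hST : Disjoint S T) (hJ : ∀ u ∈ S, ∀ x ∈ T, J u x = 0 ∧ J x u = 0)
    (f : (V → Bool) → ℝ) :
    blockVar (isingWeight J h) (S ∪ T) f ≤
      blockVar (isingWeight J h) S f + blockVar (isingWeight J h) T f := by
  refine blockVar_union_le (w := isingWeight J h) (fun _ => Real.exp_pos _) hST
    (A := fun σ => Real.exp ((1 / 2) * ∑ u : V, ∑ x : V,
      (if u ∈ T ∨ x ∈ T then 0 else J u x * spin (σ u) * spin (σ x))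
        + ∑ u : V, if u ∈ T then 0 else h u * spin (σ u)))
    (B := fun σ => Real.exp ((1 / 2) * ∑ u : V, ∑ x : V,
      (if u ∈ T ∨ x ∈ T then J u x * spin (σ u) * spin (σ x) else 0)
        + ∑ u : V, if u ∈ T then h u * spin (σ u) else 0)) ?_ ?_ ?_ f
  · intro σ
    rw [isingWeight, ← Real.exp_add, add_add_add_comm, ← mul_add]
    simp only [← Finset.sum_add_distrib]
    refine congrArg Real.exp (congrArg₂ (· + ·) (congrArg _ ?_) ?_)
    · refine Finset.sum_congr rfl fun u _ => Finset.sum_congr rfl fun x _ => ?_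
      split_ifs <;> simp
    · refine Finset.sum_congr rfl fun u _ => ?_
      split_ifs <;> simp
  · intro σ τ
    dsimp only
    refine congrArg Real.exp (congrArg₂ (· + ·) (congrArg _ ?_) ?_)
    · refine Finset.sum_congr rfl fun u _ => Finset.sum_congr rfl fun x _ => ?_
      by_cases hu : u ∈ T <;> by_cases hx : x ∈ T <;> simp [hu, hx]
    · refine Finset.sum_congr rfl fun u _ => ?_
      by_cases hu : u ∈ T <;> simp [hu]
  · intro σ τ
    dsimp only
    have hd : ∀ u ∈ T, u ∉ S := fun u hu => Finset.disjoint_right.1 hST hu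
    refine congrArg Real.exp (congrArg₂ (· + ·) (congrArg _ ?_) ?_)
    · refine Finset.sum_congr rfl fun u _ => Finset.sum_congr rfl fun x _ => ?_
      split_ifs with hux
      · by_cases hu : u ∈ S
        · have hx : x ∈ T := hux.resolve_left fun h' => hd u h' hu
          simp [(hJ u hu x hx).1]
        · by_cases hx : x ∈ S
          · have hu' : u ∈ T := hux.resolve_right fun h' => hd x h' hx
            simp [(hJ x hx u hu').2]
          · simp [hu, hx]
      · rfl
    · refine Finset.sum_congr rfl fun u _ => ?_
      by_cases hu : u ∈ T <;> simp [hu, hd]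

/-- The couplings `J` with all couplings at `v` removed. -/
noncomputable def isolate (J : V → V → ℝ) (v u x : V) : ℝ := if u = v ∨ x = v then 0 else J u x

lemma sum_abs_sub_isolate_le (G : SimpleGraph V) [DecidableRel G.Adj] {J : V → V → ℝ} {β : ℝ}
    (hβ : 0 ≤ β) (hsupp : ∀ u w, ¬ G.Adj u w → J u w = 0)
    (hJ : ∀ u w, 0 ≤ J u w ∧ J u w ≤ β) (v : V) :
    ∑ u, ∑ x, |J u x - isolate J v u x| ≤ 2 * (β * G.degree v) := by
  have h1 : ∀ u x, |J u x - isolate J v u x| ≤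
      (if u = v then (if G.Adj v x then β else 0) else 0) +
        (if x = v then (if G.Adj v u then β else 0) else 0) := by
    intro u x
    have hle : ∀ a b, J a b ≤ if G.Adj a b then β else 0 := by
      intro a b
      split_ifs with hab
      · exact (hJ a b).2
      · exact (hsupp a b hab).le
    unfold isolate
    by_cases hu : u = v
    · subst hu
      simp only [true_or, if_true, sub_zero, abs_of_nonneg (hJ u x).1]
      refine (hle u x).trans (le_add_of_nonneg_right ?_)
      split_ifs <;> simp [hβ]
    · by_cases hx : x = v
      · subst hx
        have := hle u x
        simpa [hu, abs_of_nonneg (hJ u x).1, G.adj_comm x u] using this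
      · simp [hu, hx]
  have hdeg : ∑ x, (if G.Adj v x then β else 0) = β * G.degree v := by
    rw [← Finset.sum_filter, Finset.sum_const, nsmul_eq_mul, mul_comm,
      ← G.card_neighborFinset_eq_degree, G.neighborFinset_eq_filter]
  calc _ ≤ ∑ u, ∑ x, ((if u = v then (if G.Adj v x then β else 0) else 0) +
        (if x = v then (if G.Adj v u then β else 0) else 0)) :=
        Finset.sum_le_sum fun u _ => Finset.sum_le_sum fun x _ => h1 u x
    _ = 2 * (β * G.degree v) := by
        simp only [Finset.sum_add_distrib]
        rw [Finset.sum_comm]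
        simp [hdeg, two_mul]

end Ising

section Induction

variable {V : Type} [Fintype V] [DecidableEq V]

/-- Adjacency between two vertices of `S`. -/
def adjIn (G : SimpleGraph V) (S : Finset V) (a b : V) : Prop := G.Adj a b ∧ a ∈ S ∧ b ∈ S

/-- Spectral gap bound for a block `S` all of whose vertices can be reached inside `S` from a set
`R` of roots: the constant is governed by the maximal degree sum along paths in `S` from `R`. -/
lemma blockVar_le_sum_singleton (G : SimpleGraph V) [DecidableRel G.Adj] (h : V → ℝ) {β : ℝ}
    (hβ : 0 ≤ β) (f : (V → Bool) → ℝ) (n : ℕ) :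
    ∀ (S : Finset V), S.card ≤ n → ∀ (R : Set V) (m : ℕ)
      (_ : ∀ u ∈ S, ∃ c ∈ R, c ∈ S ∧ Relation.ReflTransGen (adjIn G S) c u)
      (_ : ∀ c ∈ R, ∀ (u : V) (p : G.Walk c u), p.IsPath → (∀ x ∈ p.support, x ∈ S) →
        (p.support.map (fun x => G.degree x)).sum ≤ m)
      (J : V → V → ℝ) (_ : ∀ u w, ¬ G.Adj u w → J u w = 0)
      (_ : ∀ u w, 0 ≤ J u w ∧ J u w ≤ β),
      blockVar (isingWeight J h) S f ≤
        Real.exp (2 * β * m) * ∑ v ∈ S, blockVar (isingWeight J h) {v} f := by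
  have hpos : ∀ J : V → V → ℝ, ∀ σ, 0 < isingWeight J h σ := fun _ _ => Real.exp_pos _
  induction n with
  | zero =>
    intro S hS R m _ _ J _ _
    rw [Finset.card_eq_zero.1 (Nat.le_zero.1 hS)]
    refine (blockVar_le_sum_sq_sub (hpos J) (g := f) (fun σ τ => by simp) f).trans ?_
    simp
  | succ n ih =>
    intro S hS R m hreach hpath J hsupp hJ
    rcases S.eq_empty_or_nonempty with rfl | ⟨u₀, hu₀⟩
    · exact ih ∅ (by simp) R m hreach hpath J hsupp hJ
    obtain ⟨v, hvR, hvS, -⟩ := hreach u₀ hu₀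
    classical
    set T : Finset V := S.filter fun u => Relation.ReflTransGen (adjIn G S) v u with hTdef
    have hTS : T ⊆ S := Finset.filter_subset _ _
    have hvT : v ∈ T := Finset.mem_filter.2 ⟨hvS, .refl⟩
    by_cases hT : T = S
    · have hvpath := hpath v hvR v .nil .nil (by simpa using hvS)
      simp only [SimpleGraph.Walk.support_nil, List.map_cons, List.map_nil, List.sum_cons,
        List.sum_nil, add_zero] at hvpath
      set J' := isolate J v with hJ'
      have hsupp' : ∀ u w, ¬ G.Adj u w → J' u w = 0 := fun u w huw => by
        simp [hJ', isolate, hsupp u w huw]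
      have hJ'β : ∀ u w, 0 ≤ J' u w ∧ J' u w ≤ β := fun u w => by
        simp only [hJ', isolate]
        split_ifs
        · exact ⟨le_rfl, hβ⟩
        · exact hJ u w
      have hrest := ih (S.erase v) (by rw [Finset.card_erase_of_mem hvS]; omega)
        {c | G.Adj v c ∧ c ∈ S} (m - G.degree v) ?_ ?_ J' hsupp' hJ'β
      rotate_left
      · intro u hu
        obtain ⟨huv, huS⟩ := Finset.mem_erase.1 hu
        have hvu : Relation.ReflTransGen (adjIn G S) v u := by
          rw [← hT] at huS
          exact (Finset.mem_filter.1 huS).2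
        clear hu huS
        induction hvu with
        | refl => exact absurd rfl huv
        | @tail a b hva hab ih' =>
          have hb : b ∈ S.erase v := Finset.mem_erase.2 ⟨huv, hab.2.2⟩
          by_cases ha : a = v
          · subst ha
            exact ⟨b, ⟨hab.1, hab.2.2⟩, hb, .refl⟩
          · obtain ⟨c, hc, hcS, hca⟩ := ih' ha
            exact ⟨c, hc, hcS, hca.tail ⟨hab.1, Finset.mem_erase.2 ⟨ha, hab.2.1⟩, hb⟩⟩
      · rintro c ⟨hvc, -⟩ u p hp hpS
        have := hpath v hvR u (.cons hvc p)
          (hp.cons fun hv => by simpa using hpS v hv)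
          (by
            intro x hx
            rw [SimpleGraph.Walk.support_cons, List.mem_cons] at hx
            rcases hx with rfl | hx
            · exact hvS
            · exact Finset.mem_of_mem_erase (hpS x hx))
        rw [SimpleGraph.Walk.support_cons, List.map_cons, List.sum_cons] at this
        omega
      have hdiff := sum_abs_sub_isolate_le G hβ hsupp hJ v
      have hw1 := isingWeight_le h hdiff
      have hw2 := isingWeight_le (J := J') (J' := J) h (c := β * G.degree v)
        (by simpa only [abs_sub_comm] using hdiff)
      have hun : blockVar (isingWeight J' h) S f ≤ blockVar (isingWeight J' h) {v} f +
          blockVar (isingWeight J' h) (S.erase v) f := by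
        have := isingWeight_blockVar_union_le (J := J') h (S := {v}) (T := S.erase v)
          (by simp) (by
            intro u hu x _
            rw [Finset.mem_singleton.1 hu]
            simp [hJ', isolate]) f
        rwa [← Finset.insert_eq, Finset.insert_erase hvS] at this
      have hone : 1 ≤ Real.exp (2 * β * (m - G.degree v : ℕ)) :=
        Real.one_le_exp (by positivity)
      calc blockVar (isingWeight J h) S f
          ≤ Real.exp (β * G.degree v) * blockVar (isingWeight J' h) S f :=
            blockVar_mono (hpos J) hw1 S f
        _ ≤ Real.exp (β * G.degree v) * (Real.exp (2 * β * (m - G.degree v : ℕ)) *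
              ∑ u ∈ S, blockVar (isingWeight J' h) {u} f) := by
            gcongr
            rw [← Finset.add_sum_erase S _ hvS, mul_add]
            exact hun.trans (add_le_add
              (le_mul_of_one_le_left (blockVar_nonneg (hpos J') _ _) hone) hrest)
        _ ≤ Real.exp (β * G.degree v) * (Real.exp (2 * β * (m - G.degree v : ℕ)) *
              ∑ u ∈ S, Real.exp (β * G.degree v) * blockVar (isingWeight J h) {u} f) := by
            gcongr with u _
            exact blockVar_mono (hpos J') hw2 {u} f
        _ = Real.exp (2 * β * m) * ∑ u ∈ S, blockVar (isingWeight J h) {u} f := by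
            rw [← Finset.mul_sum, ← mul_assoc, ← mul_assoc, ← Real.exp_add, ← Real.exp_add,
              Nat.cast_sub hvpath]
            ring_nf
    · have hclosed : ∀ a b, a ∈ T → adjIn G S a b → b ∈ T := fun a b ha hab =>
        Finset.mem_filter.2 ⟨hab.2.2, (Finset.mem_filter.1 ha).2.tail hab⟩
      have hTcard : T.card ≤ n := by
        have := Finset.card_lt_card (hTS.ssubset_of_ne hT)
        omega
      have hDcard : (S \ T).card ≤ n := by
        have := Finset.card_lt_card (Finset.sdiff_ssubset hTS ⟨v, hvT⟩)
        omega
      have h1 := ih T hTcard {v} m ?_ ?_ J hsupp hJ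
      · have h2 := ih (S \ T) hDcard R m ?_ ?_ J hsupp hJ
        · have hun := isingWeight_blockVar_union_le (J := J) h
            (Finset.disjoint_sdiff (s := T) (t := S)) (by
              intro u hu x hx
              obtain ⟨hxS, hxT⟩ := Finset.mem_sdiff.1 hx
              have hux : ¬ G.Adj u x := fun hadj =>
                hxT (hclosed u x hu ⟨hadj, hTS hu, hxS⟩)
              exact ⟨hsupp _ _ hux, hsupp _ _ fun hadj => hux hadj.symm⟩) f
          rw [Finset.union_sdiff_of_subset hTS] at hun
          rw [← Finset.sum_sdiff hTS, mul_add]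
          linarith
        · intro u hu
          obtain ⟨huS, huT⟩ := Finset.mem_sdiff.1 hu
          obtain ⟨c, hcR, hcS, hcu⟩ := hreach u huS
          suffices c ∈ S \ T ∧ Relation.ReflTransGen (adjIn G (S \ T)) c u from
            ⟨c, hcR, this⟩
          clear hu huS
          induction hcu with
          | refl => exact ⟨Finset.mem_sdiff.2 ⟨hcS, huT⟩, .refl⟩
          | @tail a b hca hab ih' =>
            have haT : a ∉ T := fun ha => huT (hclosed a b ha hab)
            obtain ⟨hc, hca'⟩ := ih' haT
            exact ⟨hc, hca'.tail ⟨hab.1, Finset.mem_sdiff.2 ⟨hab.2.1, haT⟩,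
              Finset.mem_sdiff.2 ⟨hab.2.2, huT⟩⟩⟩
        · exact fun c hc u p hp hpS =>
            hpath c hc u p hp fun x hx => (Finset.mem_sdiff.1 (hpS x hx)).1
      · intro u hu
        refine ⟨v, rfl, hvT, ?_⟩
        have hvu := (Finset.mem_filter.1 hu).2
        clear hu
        induction hvu with
        | refl => exact .refl
        | @tail a b hva hab ih' =>
          have ha : a ∈ T := Finset.mem_filter.2 ⟨hab.2.1, hva⟩
          exact ih'.tail ⟨hab.1, ha, hclosed a b ha hab⟩
      · rintro c rfl u p hp hpS
        exact hpath c hvR u p hp fun x hx => hTS (hpS x hx)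

end Induction

/-- For the continuous-time heat-bath Gibbs sampler of the Ising model on
a finite tree `T` with interactions `0 ≤ J ≤ β` and arbitrary external fields (boundary
conditions being encoded by the external fields), the relaxation time is at most
`exp(4 β m(T))`, where `m(T)` is the maximal sum of vertex degrees along a simple path
from the root.  Variationally: `Var_P(f) ≤ exp(4 β m) · E(f,f)` for every observable
`f`, where `E` is the Dirichlet form of the heat-bath dynamics. -/
theorem stmt12 {V : Type} [Fintype V] [DecidableEq V]
    (G : SimpleGraph V) [DecidableRel G.Adj] (hT : G.IsTree) (r : V)
    (J : V → V → ℝ) (h : V → ℝ) (β : ℝ) (hβ : 0 ≤ β)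
    (hsymm : ∀ u w, J u w = J w u)
    (hsupp : ∀ u w, ¬ G.Adj u w → J u w = 0)
    (hJ : ∀ u w, 0 ≤ J u w ∧ J u w ≤ β)
    (m : ℕ)
    (hm : ∀ (u : V) (p : G.Walk r u), p.IsPath →
      (p.support.map (fun x => G.degree x)).sum ≤ m) :
    let w : (V → Bool) → ℝ := fun σ =>
      Real.exp ((1 / 2) * ∑ u : V, ∑ x : V, J u x * spin (σ u) * spin (σ x)
        + ∑ u : V, h u * spin (σ u))
    let P : (V → Bool) → ℝ := fun σ => w σ / ∑ σ' : V → Bool, w σ'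
    let flip : (V → Bool) → V → (V → Bool) := fun σ v => Function.update σ v (! σ v)
    let rate : (V → Bool) → V → ℝ := fun σ v => w (flip σ v) / (w σ + w (flip σ v))
    let dirichlet : ((V → Bool) → ℝ) → ℝ := fun f =>
      (1 / 2) * ∑ σ : V → Bool, ∑ v : V, P σ * rate σ v * (f (flip σ v) - f σ) ^ 2
    let variance : ((V → Bool) → ℝ) → ℝ := fun f =>
      (∑ σ : V → Bool, P σ * (f σ) ^ 2) - (∑ σ : V → Bool, P σ * f σ) ^ 2
    ∀ f : (V → Bool) → ℝ, variance f ≤ Real.exp (4 * β * m) * dirichlet f := by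
  intro w P flip rate dirichlet variance f
  have hw : ∀ σ, 0 < w σ := fun σ => Real.exp_pos _
  have hZ : 0 < ∑ σ', w σ' := Finset.sum_pos (fun σ _ => hw σ) Finset.univ_nonempty
  set Z := ∑ σ', w σ' with hZdef
  have hP1 : ∑ σ, P σ = 1 := by
    simp only [P, ← Finset.sum_div]
    exact div_self hZ.ne'
  have hmain : blockVar w Finset.univ f ≤
      Real.exp (2 * β * m) * ∑ v, blockVar w {v} f := by
    refine blockVar_le_sum_singleton G h hβ f _ Finset.univ le_rfl {r} m ?_ ?_ J hsupp hJ
    · intro u _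
      refine ⟨r, rfl, Finset.mem_univ _, ?_⟩
      have := (SimpleGraph.reachable_iff_reflTransGen r u).1 (hT.connected.preconnected r u)
      exact Relation.ReflTransGen.mono (p := adjIn G Finset.univ)
        (fun a b hab => ⟨hab, Finset.mem_univ _, Finset.mem_univ _⟩) _ _ this
    · rintro c rfl u p hp -
      exact hm u p hp
  have hvar : variance f ≤ blockVar w Finset.univ f / Z := by
    set c := blockMean w Finset.univ f (fun _ => true) with hc
    have hconst : ∀ σ, blockMean w Finset.univ f σ = c := fun σ => by
      simp [hc, blockMean]
    have hB : blockVar w Finset.univ f / Z = ∑ σ, P σ * (f σ - c) ^ 2 := by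
      simp only [blockVar, hconst, Finset.sum_div, P]
      exact Finset.sum_congr rfl fun σ _ => by ring
    have hexp : ∑ σ, P σ * (f σ - c) ^ 2 =
        ∑ σ, P σ * f σ ^ 2 - 2 * c * ∑ σ, P σ * f σ + c ^ 2 * ∑ σ, P σ := by
      simp only [Finset.mul_sum, ← Finset.sum_sub_distrib, ← Finset.sum_add_distrib]
      exact Finset.sum_congr rfl fun σ _ => by ring
    rw [hB, hexp, hP1]
    simp only [variance]
    nlinarith [sq_nonneg (∑ σ, P σ * f σ - c)]
  have hdir : (∑ v, blockVar w {v} f) / Z ≤ dirichlet f := by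
    have hd : dirichlet f = (∑ v, (1 / 2) * ∑ σ, w σ * rate σ v *
        (f (flip σ v) - f σ) ^ 2) / Z := by
      simp only [dirichlet]
      rw [← Finset.mul_sum, Finset.sum_comm, mul_div_assoc, Finset.sum_div]
      congr 1
      refine Finset.sum_congr rfl fun v _ => ?_
      rw [Finset.sum_div]
      exact Finset.sum_congr rfl fun σ _ => by simp only [P]; ring
    rw [hd]
    gcongr with v _
    exact blockVar_singleton_le hw v f
  have hnn : 0 ≤ (∑ v, blockVar w {v} f) / Z :=
    div_nonneg (Finset.sum_nonneg fun v _ => blockVar_nonneg hw _ _) hZ.le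
  calc variance f ≤ blockVar w Finset.univ f / Z := hvar
    _ ≤ Real.exp (2 * β * m) * ((∑ v, blockVar w {v} f) / Z) := by
        rw [← mul_div_assoc]
        gcongr
    _ ≤ Real.exp (4 * β * m) * dirichlet f := by
        refine mul_le_mul (Real.exp_le_exp.2 ?_) hdir hnn (Real.exp_pos _).le
        nlinarith [mul_nonneg hβ (Nat.cast_nonneg (α := ℝ) m)]
end
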